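/- Let N be a natural number, let {φ_{m,n,l}}_{m,n∈ℤ, l∈{1,…,N}} and {ψ_{m,n,l}}_{m,n∈ℤ, l∈{1,…,N}} be frames for L²(ℝ) with frame bounds A_1, B_1 and A_2, B_2 respectively. Let {α_{m,n,l}} and {β_{m,n,l}} be bounded families of complex scalars indexed by ℤ×ℤ×{1,…,N} such that 2 (sup |α_{m,n,l}|)(sup |β_{m,n,l}|) √(B_1 B_2) < (inf |α_{m,n,l}|)² A_1 + (inf |β_{m,n,l}|)² A_2. Then {α_{m,n,l} φ_{m,n,l} + β_{m,n,l} ψ_{m,n,l}}_{m,n∈ℤ, l∈{1,…,N}} is a frame for L²(ℝ) with frame bounds (inf |α_{m,n,l}|)² A_1 + (inf |β_{m,n,l}|)² A_2 − 2 (sup |α_{m,n,l}|)(sup |β_{m,n,l}|) √(B_1 B_2) (lower bound) and ((sup |α_{m,n,l}|) √(B_1) + (sup |β_{m,n,l}|) √(B_2))² (upper bound). -/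

import Mathlib

open MeasureTheory
open scoped ComplexInnerProductSpace

noncomputable section

/-- `L²(ℝ)`: the space of (equivalence classes of) square-integrable complex-valued
functions on `ℝ`. -/
abbrev L2R := Lp ℂ 2 (volume : MeasureTheory.Measure ℝ)

/-- A family of vectors indexed by `ℤ × ℤ × {1,…,N}` is a frame for `L²(ℝ)` with
frame bounds `A`, `B` if `A‖f‖² ≤ Σ |⟨f, gₐ⟩|² ≤ B‖f‖²` for all `f`. -/
def IsFrame {N : ℕ} (g : ℤ × ℤ × Fin N → L2R) (A B : ℝ) : Prop :=
  0 < A ∧ A ≤ B ∧ ∀ f : L2R,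
    A * ‖f‖ ^ 2 ≤ (∑' idx : ℤ × ℤ × Fin N, ‖(⟪f, g idx⟫)‖ ^ 2) ∧
    (∑' idx : ℤ × ℤ × Fin N, ‖(⟪f, g idx⟫)‖ ^ 2) ≤ B * ‖f‖ ^ 2

theorem IsFrame.summable {N : ℕ} {g : ℤ × ℤ × Fin N → L2R} {A B : ℝ} (h : IsFrame g A B)
    (f : L2R) : Summable fun idx => ‖(⟪f, g idx⟫)‖ ^ 2 := by
  by_contra hs
  have h1 := (h.2.2 f).1
  rw [tsum_eq_zero_of_not_summable hs] at h1
  have hf : f ≠ 0 := by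
    rintro rfl
    apply hs
    simpa using summable_zero
  have : 0 < A * ‖f‖ ^ 2 := mul_pos h.1 (pow_pos (norm_pos_iff.2 hf) 2)
  linarith

/-- **Perturbed sums of frames.**  If `{φₐ}`, `{ψₐ}` are frames for `L²(ℝ)` with bounds
`A₁, B₁` and `A₂, B₂`, and `{αₐ}`, `{βₐ}` are bounded families of scalars satisfying
`2 (sup|αₐ|)(sup|βₐ|) √(B₁B₂) < (inf|αₐ|)² A₁ + (inf|βₐ|)² A₂`, then
`{αₐ φₐ + βₐ ψₐ}` is a frame for `L²(ℝ)` with bounds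
`(inf|αₐ|)² A₁ + (inf|βₐ|)² A₂ − 2 (sup|αₐ|)(sup|βₐ|) √(B₁B₂)` and
`((sup|αₐ|) √B₁ + (sup|βₐ|) √B₂)²`. -/
theorem perturbed_sum_of_frames_isFrame (N : ℕ)
    (φ ψ : ℤ × ℤ × Fin N → L2R) (A₁ B₁ A₂ B₂ : ℝ)
    (hφ : IsFrame φ A₁ B₁) (hψ : IsFrame ψ A₂ B₂)
    (α β : ℤ × ℤ × Fin N → ℂ)
    (hα : BddAbove (Set.range fun idx => ‖α idx‖))
    (hβ : BddAbove (Set.range fun idx => ‖β idx‖))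
    (hcond : 2 * (⨆ idx, ‖α idx‖) * (⨆ idx, ‖β idx‖) * Real.sqrt (B₁ * B₂)
      < (⨅ idx, ‖α idx‖) ^ 2 * A₁ + (⨅ idx, ‖β idx‖) ^ 2 * A₂) :
    IsFrame (fun idx => α idx • φ idx + β idx • ψ idx)
      ((⨅ idx, ‖α idx‖) ^ 2 * A₁ + (⨅ idx, ‖β idx‖) ^ 2 * A₂
        - 2 * (⨆ idx, ‖α idx‖) * (⨆ idx, ‖β idx‖) * Real.sqrt (B₁ * B₂))
      (((⨆ idx, ‖α idx‖) * Real.sqrt B₁ + (⨆ idx, ‖β idx‖) * Real.sqrt B₂) ^ 2) := by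
  obtain ⟨hA1, hAB1, hf1⟩ := id hφ
  obtain ⟨hA2, hAB2, hf2⟩ := id hψ
  have hB1 : 0 < B₁ := hA1.trans_le hAB1
  have hB2 : 0 < B₂ := hA2.trans_le hAB2
  have haS : ∀ i, ‖α i‖ ≤ ⨆ idx, ‖α idx‖ := fun i => le_ciSup hα i
  have hbT : ∀ i, ‖β i‖ ≤ ⨆ idx, ‖β idx‖ := fun i => le_ciSup hβ i
  have haI : ∀ i, (⨅ idx, ‖α idx‖) ≤ ‖α i‖ := fun i =>
    ciInf_le ⟨0, by rintro _ ⟨j, rfl⟩; exact norm_nonneg _⟩ i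
  have hbI : ∀ i, (⨅ idx, ‖β idx‖) ≤ ‖β i‖ := fun i =>
    ciInf_le ⟨0, by rintro _ ⟨j, rfl⟩; exact norm_nonneg _⟩ i
  have ha0 : 0 ≤ ⨅ idx, ‖α idx‖ := Real.iInf_nonneg fun _ => norm_nonneg _
  have hb0 : 0 ≤ ⨅ idx, ‖β idx‖ := Real.iInf_nonneg fun _ => norm_nonneg _
  have hS0 : 0 ≤ ⨆ idx, ‖α idx‖ := Real.iSup_nonneg fun _ => norm_nonneg _
  have hT0 : 0 ≤ ⨆ idx, ‖β idx‖ := Real.iSup_nonneg fun _ => norm_nonneg _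
  have haleS : (⨅ idx, ‖α idx‖) ≤ ⨆ idx, ‖α idx‖ := by
    rcases isEmpty_or_nonempty (ℤ × ℤ × Fin N) with h | ⟨⟨i⟩⟩
    · simp
    · exact (haI i).trans (haS i)
  have hbleT : (⨅ idx, ‖β idx‖) ≤ ⨆ idx, ‖β idx‖ := by
    rcases isEmpty_or_nonempty (ℤ × ℤ × Fin N) with h | ⟨⟨i⟩⟩
    · simp
    · exact (hbI i).trans (hbT i)
  rw [Real.sqrt_mul hB1.le] at hcond ⊢
  generalize (⨅ idx, ‖α idx‖) = a at *
  generalize (⨅ idx, ‖β idx‖) = b at *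
  generalize (⨆ idx, ‖α idx‖) = S at *
  generalize (⨆ idx, ‖β idx‖) = T at *
  have hs1 : 0 < √B₁ := Real.sqrt_pos.2 hB1
  have hs2 : 0 < √B₂ := Real.sqrt_pos.2 hB2
  have hq1 : √B₁ ^ 2 = B₁ := Real.sq_sqrt hB1.le
  have hq2 : √B₂ ^ 2 = B₂ := Real.sq_sqrt hB2.le
  generalize √B₁ = s at *
  generalize √B₂ = t at *
  subst hq1 hq2
  have hST : 0 ≤ S * T := mul_nonneg hS0 hT0
  refine ⟨by linarith, ?_, fun f => ?_⟩
  · have h1 : a ^ 2 * A₁ ≤ S ^ 2 * s ^ 2 := by gcongr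
    have h2 : b ^ 2 * A₂ ≤ T ^ 2 * t ^ 2 := by gcongr
    have h3 : 0 ≤ S * T * (s * t) := by positivity
    nlinarith
  have hX := hφ.summable f
  have hY := hψ.summable f
  obtain ⟨hl1, hu1⟩ := hf1 f
  obtain ⟨hl2, hu2⟩ := hf2 f
  have hxy : ∀ x y : ℝ, 2 * (x * y) ≤ t / s * x ^ 2 + s / t * y ^ 2 := by
    intro x y
    have : t / s * x ^ 2 + s / t * y ^ 2 - 2 * (x * y) = (t * x - s * y) ^ 2 / (s * t) := by
      field_simp
      ring
    have h2 : 0 ≤ (t * x - s * y) ^ 2 / (s * t) := by positivity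
    linarith
  have hterm : ∀ i, ⟪f, α i • φ i + β i • ψ i⟫ = α i * ⟪f, φ i⟫ + β i * ⟪f, ψ i⟫ := by
    intro i
    rw [inner_add_right, inner_smul_right, inner_smul_right]
  have hcross : ∀ i, 2 * ((‖α i‖ * ‖(⟪f, φ i⟫)‖) * (‖β i‖ * ‖(⟪f, ψ i⟫)‖)) ≤
      S * T * (t / s * ‖(⟪f, φ i⟫)‖ ^ 2 + s / t * ‖(⟪f, ψ i⟫)‖ ^ 2) := by
    intro i
    calc _ = ‖α i‖ * ‖β i‖ * (2 * (‖(⟪f, φ i⟫)‖ * ‖(⟪f, ψ i⟫)‖)) := by ring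
      _ ≤ S * T * (2 * (‖(⟪f, φ i⟫)‖ * ‖(⟪f, ψ i⟫)‖)) := by
        gcongr
        · exact haS i
        · exact hbT i
      _ ≤ _ := mul_le_mul_of_nonneg_left (hxy _ _) hST
  have hup : ∀ i, ‖(⟪f, α i • φ i + β i • ψ i⟫)‖ ^ 2 ≤
      (S ^ 2 + S * T * (t / s)) * ‖(⟪f, φ i⟫)‖ ^ 2
        + (T ^ 2 + S * T * (s / t)) * ‖(⟪f, ψ i⟫)‖ ^ 2 := by
    intro i
    rw [hterm]
    have h1 := norm_add_le (α i * ⟪f, φ i⟫) (β i * ⟪f, ψ i⟫)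
    rw [norm_mul, norm_mul] at h1
    have h2 := pow_le_pow_left₀ (norm_nonneg _) h1 2
    have h3 := hcross i
    have h4 : (‖α i‖ * ‖(⟪f, φ i⟫)‖) ^ 2 ≤ S ^ 2 * ‖(⟪f, φ i⟫)‖ ^ 2 := by
      rw [mul_pow]
      gcongr
      exact haS i
    have h5 : (‖β i‖ * ‖(⟪f, ψ i⟫)‖) ^ 2 ≤ T ^ 2 * ‖(⟪f, ψ i⟫)‖ ^ 2 := by
      rw [mul_pow]
      gcongr
      exact hbT i
    linarith
  have hlow : ∀ i, (a ^ 2 - S * T * (t / s)) * ‖(⟪f, φ i⟫)‖ ^ 2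
        + (b ^ 2 - S * T * (s / t)) * ‖(⟪f, ψ i⟫)‖ ^ 2 ≤
      ‖(⟪f, α i • φ i + β i • ψ i⟫)‖ ^ 2 := by
    intro i
    rw [hterm]
    have h1 := abs_norm_sub_norm_le (α i * ⟪f, φ i⟫) (-(β i * ⟪f, ψ i⟫))
    rw [norm_neg, norm_mul, norm_mul, sub_neg_eq_add] at h1
    have h2 := pow_le_pow_left₀ (abs_nonneg _) h1 2
    rw [sq_abs] at h2
    have h3 := hcross i
    have h4 : a ^ 2 * ‖(⟪f, φ i⟫)‖ ^ 2 ≤ (‖α i‖ * ‖(⟪f, φ i⟫)‖) ^ 2 := by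
      rw [mul_pow]
      gcongr
      exact haI i
    have h5 : b ^ 2 * ‖(⟪f, ψ i⟫)‖ ^ 2 ≤ (‖β i‖ * ‖(⟪f, ψ i⟫)‖) ^ 2 := by
      rw [mul_pow]
      gcongr
      exact hbI i
    linarith
  have hsU := (hX.mul_left (S ^ 2 + S * T * (t / s))).add (hY.mul_left (T ^ 2 + S * T * (s / t)))
  have hsL := (hX.mul_left (a ^ 2 - S * T * (t / s))).add (hY.mul_left (b ^ 2 - S * T * (s / t)))
  have hsum : Summable fun i => ‖(⟪f, α i • φ i + β i • ψ i⟫)‖ ^ 2 :=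
    Summable.of_nonneg_of_le (fun i => by positivity) hup hsU
  have hU := hsum.tsum_le_tsum hup hsU
  have hL := hsL.tsum_le_tsum hlow hsum
  rw [(hX.mul_left _).tsum_add (hY.mul_left _), tsum_mul_left, tsum_mul_left] at hU hL
  generalize (∑' i, ‖(⟪f, φ i⟫)‖ ^ 2) = X at *
  generalize (∑' i, ‖(⟪f, ψ i⟫)‖ ^ 2) = Y at *
  have e1 : S * T * (t / s) * X ≤ S * T * (s * t) * ‖f‖ ^ 2 := by
    calc _ ≤ S * T * (t / s) * (s ^ 2 * ‖f‖ ^ 2) := by gcongr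
      _ = _ := by field_simp
  have e2 : S * T * (s / t) * Y ≤ S * T * (s * t) * ‖f‖ ^ 2 := by
    calc _ ≤ S * T * (s / t) * (t ^ 2 * ‖f‖ ^ 2) := by gcongr
      _ = _ := by field_simp
  constructor
  · have e3 := mul_le_mul_of_nonneg_left hl1 (sq_nonneg a)
    have e4 := mul_le_mul_of_nonneg_left hl2 (sq_nonneg b)
    refine le_trans ?_ hL
    linarith
  · have e3 := mul_le_mul_of_nonneg_left hu1 (sq_nonneg S)
    have e4 := mul_le_mul_of_nonneg_left hu2 (sq_nonneg T)
    refine hU.trans ?_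
    linarith
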